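/- In the model-based fictitious play under Assumption 1, for every state s ∈ S: lim_{k→∞} ‖Q̂_{1,s,k} + Q̂_{2,s,k}‖_max = 0; that is, the beliefs on the two players' Q-functions asymptotically sum to zero at every state. -/

import Mathlib

open Finset Filter Topology

/-- Model-based fictitious play in a finite two-player zero-sum stochastic game. -/
structure MBFP (S A1 A2 : Type) [Fintype S] [Fintype A1] [Fintype A2]
    [Nonempty S] [Nonempty A1] [Nonempty A2]
    [DecidableEq S] [DecidableEq A1] [DecidableEq A2] where
  /-- stage payoff of player 1 -/
  r1 : S → A1 → A2 → ℝ
  /-- stage payoff of player 2 -/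
  r2 : S → A1 → A2 → ℝ
  /-- transition probabilities: `p s a b s'` is the probability of moving to `s'` -/
  p : S → A1 → A2 → S → ℝ
  /-- discount factor -/
  γ : ℝ
  zerosum : ∀ s a b, r1 s a b + r2 s a b = 0
  p_nonneg : ∀ s a b s', 0 ≤ p s a b s'
  p_sum_one : ∀ s a b, ∑ s', p s a b s' = 1
  γ_nonneg : 0 ≤ γ
  γ_lt_one : γ < 1
  /-- the realized state sequence -/
  st : ℕ → S
  /-- step sizes for beliefs on strategies -/
  α : ℕ → ℝ
  /-- step sizes for beliefs on Q-functions -/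
  β : ℕ → ℝ
  α_mem : ∀ c, α c ∈ Set.Ioc (0:ℝ) 1
  β_mem : ∀ c, β c ∈ Set.Ioc (0:ℝ) 1
  /-- belief (held by player 2) on player 1's mixed action at each state -/
  π1 : S → ℕ → A1 → ℝ
  /-- belief (held by player 1) on player 2's mixed action at each state -/
  π2 : S → ℕ → A2 → ℝ
  /-- player 1's belief on its own Q-function -/
  Q1 : S → ℕ → A1 → A2 → ℝ
  /-- player 2's belief on its own Q-function -/
  Q2 : S → ℕ → A1 → A2 → ℝ
  /-- best-response action of player 1 at stage k -/
  astar1 : ℕ → A1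
  /-- best-response action of player 2 at stage k -/
  astar2 : ℕ → A2
  π1_simplex : ∀ s k, π1 s k ∈ stdSimplex ℝ A1
  π2_simplex : ∀ s k, π2 s k ∈ stdSimplex ℝ A2
  Q1_init : ∀ s, Q1 s 0 = r1 s
  Q2_init : ∀ s, Q2 s 0 = r2 s
  astar1_br : ∀ k b,
    ∑ b2, Q1 (st k) k b b2 * π2 (st k) k b2
      ≤ ∑ b2, Q1 (st k) k (astar1 k) b2 * π2 (st k) k b2
  astar2_br : ∀ k b,
    ∑ b1, π1 (st k) k b1 * Q2 (st k) k b1 b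
      ≤ ∑ b1, π1 (st k) k b1 * Q2 (st k) k b1 (astar2 k)
  π1_upd : ∀ s k, π1 s (k+1) = fun b =>
    π1 s k b + (if s = st k then α (((Finset.range k).filter fun k' => st k' = s).card) else 0)
      * ((if b = astar1 k then (1:ℝ) else 0) - π1 s k b)
  π2_upd : ∀ s k, π2 s (k+1) = fun b =>
    π2 s k b + (if s = st k then α (((Finset.range k).filter fun k' => st k' = s).card) else 0)
      * ((if b = astar2 k then (1:ℝ) else 0) - π2 s k b)
  Q1_upd : ∀ s k, Q1 s (k+1) = fun b1 b2 =>
    Q1 s k b1 b2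
      + (if s = st k then β (((Finset.range k).filter fun k' => st k' = s).card) else 0)
        * (r1 s b1 b2
          + γ * ∑ s', (Finset.univ.sup' Finset.univ_nonempty fun c1 =>
              ∑ b2', Q1 s' k c1 b2' * π2 s' k b2') * p s b1 b2 s'
          - Q1 s k b1 b2)
  Q2_upd : ∀ s k, Q2 s (k+1) = fun b1 b2 =>
    Q2 s k b1 b2
      + (if s = st k then β (((Finset.range k).filter fun k' => st k' = s).card) else 0)
        * (r2 s b1 b2
          + γ * ∑ s', (Finset.univ.sup' Finset.univ_nonempty fun c2 =>
              ∑ b1', π1 s' k b1' * Q2 s' k b1' c2) * p s b1 b2 s'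
          - Q2 s k b1 b2)

variable {S A1 A2 : Type} [Fintype S] [Fintype A1] [Fintype A2]
    [Nonempty S] [Nonempty A1] [Nonempty A2]
    [DecidableEq S] [DecidableEq A1] [DecidableEq A2]

/-- the largest absolute value of an entry of a matrix -/
noncomputable def maxNorm (Q : A1 → A2 → ℝ) : ℝ :=
  Finset.univ.sup' Finset.univ_nonempty fun q : A1 × A2 => |Q q.1 q.2|

namespace MBFP

/-- the number of visits to state `s` before stage `k` -/
def cnt (G : MBFP S A1 A2) (s : S) (k : ℕ) : ℕ :=
  ((Finset.range k).filter fun k' => G.st k' = s).card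

/-- player 1's estimate of its continuation payoff at state `s` -/
noncomputable def vhat1 (G : MBFP S A1 A2) (k : ℕ) (s : S) : ℝ :=
  Finset.univ.sup' Finset.univ_nonempty fun b1 => ∑ b2, G.Q1 s k b1 b2 * G.π2 s k b2

/-- player 2's estimate of its continuation payoff at state `s` -/
noncomputable def vhat2 (G : MBFP S A1 A2) (k : ℕ) (s : S) : ℝ :=
  Finset.univ.sup' Finset.univ_nonempty fun b2 => ∑ b1, G.π1 s k b1 * G.Q2 s k b1 b2

/-- Assumption 1 of the paper -/
def Assumption1 (G : MBFP S A1 A2) : Prop :=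
  (∀ s, Tendsto (fun k => G.cnt s k) atTop atTop) ∧
  Tendsto (fun n => ∑ c ∈ Finset.range n, G.α c) atTop atTop ∧
  Tendsto (fun n => ∑ c ∈ Finset.range n, G.β c) atTop atTop ∧
  Tendsto G.α atTop (𝓝 0) ∧
  Tendsto G.β atTop (𝓝 0) ∧
  Tendsto (fun c => G.β c / G.α c) atTop (𝓝 0)

end MBFP

section Decay

/-- A Lipschitz function on the whole line with `W' ≤ -W` almost everywhere is nonpositive. -/
lemma LipschitzWith.nonpos_of_ae_deriv_le_neg {W : ℝ → ℝ} {K : NNReal} (hL : LipschitzWith K W)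
    (hd : ∀ᵐ t, deriv W t ≤ -W t) : W 0 ≤ 0 := by
  have key : ∀ T : ℝ, 0 ≤ T → W 0 ≤ (W 0 + K * T) * Real.exp (-T) := by
    intro T hT
    have hac : AbsolutelyContinuousOnInterval W (-T) 0 :=
      (hL.lipschitzOnWith (s := Set.uIcc (-T) 0)).absolutelyContinuousOnInterval
    have hexp : AbsolutelyContinuousOnInterval Real.exp (-T) 0 :=
      (Real.contDiff_exp.contDiffOn).absolutelyContinuousOnInterval
    have hpart := hac.integral_deriv_mul_eq_sub hexp
    have hnp : ∫ x in (-T)..0, deriv W x * Real.exp x + W x * deriv Real.exp x ≤ 0 := by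
      rw [intervalIntegral.integral_of_le (by linarith)]
      refine MeasureTheory.integral_nonpos_of_ae
        ((MeasureTheory.ae_restrict_of_ae hd).mono fun x hx => ?_)
      have := mul_le_mul_of_nonneg_right hx (Real.exp_pos x).le
      simp only [Real.deriv_exp, Pi.zero_apply]
      linarith
    rw [hpart, Real.exp_zero, mul_one] at hnp
    have hW : W (-T) ≤ W 0 + K * T := by
      have h1 := hL.dist_le_mul (-T) 0
      rw [Real.dist_eq, Real.dist_eq, sub_zero, abs_neg, abs_of_nonneg hT] at h1
      linarith [le_abs_self (W (-T) - W 0)]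
    nlinarith [mul_le_mul_of_nonneg_right hW (Real.exp_pos (-T)).le]
  have hlim : Tendsto (fun T : ℝ => (W 0 + K * T) * Real.exp (-T)) atTop (𝓝 0) := by
    have h0 := (Real.tendsto_pow_mul_exp_neg_atTop_nhds_zero 0).const_mul (W 0)
    have h1 := (Real.tendsto_pow_mul_exp_neg_atTop_nhds_zero 1).const_mul (K : ℝ)
    have := h0.add h1
    simp only [mul_zero, add_zero] at this
    refine this.congr fun T => ?_
    ring
  exact ge_of_tendsto hlim ((eventually_ge_atTop 0).mono key)

/-- A one-sided quadratic lower bound on increments bounds the derivative from below. -/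
lemma HasDerivAt.neg_le_of_increment {f : ℝ → ℝ} {f' t m δ : ℝ} (hf : HasDerivAt f f' t)
    (hδ : 0 < δ) (h : ∀ u, 0 < u → u < δ → -(u * (m + u)) ≤ f (t + u) - f t) : -m ≤ f' := by
  have hs := hf.tendsto_slope_zero_right
  have hl : Tendsto (fun u : ℝ => -(m + u)) (𝓝[>] 0) (𝓝 (-(m + 0))) :=
    ((continuous_const.add continuous_id).neg.tendsto 0).mono_left nhdsWithin_le_nhds
  rw [add_zero] at hl
  refine le_of_tendsto_of_tendsto hl hs ?_
  filter_upwards [Ioo_mem_nhdsGT hδ] with u hu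
  have := h u hu.1 hu.2
  rw [smul_eq_mul, inv_mul_eq_div, le_div_iff₀ hu.1]
  linarith

/-- A one-sided quadratic upper bound on increments bounds the derivative from above. -/
lemma HasDerivAt.le_neg_of_increment {f : ℝ → ℝ} {f' t m δ : ℝ} (hf : HasDerivAt f f' t)
    (hδ : 0 < δ) (h : ∀ u, 0 < u → u < δ → f (t + u) - f t ≤ -(u * (m - u))) : f' ≤ -m := by
  have := hf.neg.neg_le_of_increment (m := -m) hδ fun u hu hu' => by
    have := h u hu hu'
    simp only [Pi.neg_apply]
    linarith
  linarith

end Decay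

section Clock

/-- The time elapsed before stage `n` when stage `k` lasts `α k`. -/
noncomputable def elapsed (α : ℕ → ℝ) (n : ℕ) : ℝ := ∑ k ∈ Finset.range n, α k

/-- The first stage at which the elapsed time is at least `r`. -/
noncomputable def stageAt (α : ℕ → ℝ) (r : ℝ) : ℕ := sInf {n | r ≤ elapsed α n}

variable {α : ℕ → ℝ}

lemma elapsed_succ (n : ℕ) : elapsed α (n + 1) = elapsed α n + α n :=
  Finset.sum_range_succ _ _

lemma elapsed_mono (h0 : ∀ k, 0 ≤ α k) : Monotone (elapsed α) :=
  monotone_nat_of_le_succ fun n => by rw [elapsed_succ]; linarith [h0 n]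

lemma le_elapsed_stageAt (hS : Tendsto (elapsed α) atTop atTop) (r : ℝ) :
    r ≤ elapsed α (stageAt α r) :=
  Nat.sInf_mem (s := {n | r ≤ elapsed α n}) (hS.eventually_ge_atTop r).exists

lemma stageAt_mono (hS : Tendsto (elapsed α) atTop atTop) : Monotone (stageAt α) := fun _ s h =>
  Nat.sInf_le (h.trans (le_elapsed_stageAt hS s))

lemma elapsed_stageAt_elapsed (h0 : ∀ k, 0 ≤ α k) (hS : Tendsto (elapsed α) atTop atTop) (n : ℕ) :
    elapsed α (stageAt α (elapsed α n)) = elapsed α n :=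
  le_antisymm (elapsed_mono h0 (Nat.sInf_le (le_refl (elapsed α n)))) (le_elapsed_stageAt hS _)

lemma tendsto_stageAt (h0 : ∀ k, 0 ≤ α k) (hS : Tendsto (elapsed α) atTop atTop) :
    Tendsto (stageAt α) atTop atTop := by
  refine tendsto_atTop.2 fun n => ?_
  filter_upwards [eventually_gt_atTop (elapsed α n)] with r hr
  by_contra! hlt
  linarith [elapsed_mono h0 hlt.le, le_elapsed_stageAt hS r]

lemma tendsto_elapsed_stageAt_sub (h0 : ∀ k, 0 ≤ α k) (hα : Tendsto α atTop (𝓝 0))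
    (hS : Tendsto (elapsed α) atTop atTop) :
    Tendsto (fun r => elapsed α (stageAt α r) - r) atTop (𝓝 0) := by
  have h1 : Tendsto (fun r => α (stageAt α r - 1)) atTop (𝓝 0) :=
    hα.comp ((tendsto_sub_atTop_nat 1).comp (tendsto_stageAt h0 hS))
  refine squeeze_zero' (.of_forall fun r => sub_nonneg.2 (le_elapsed_stageAt hS r)) ?_ h1
  filter_upwards [(tendsto_stageAt h0 hS).eventually_ge_atTop 1] with r hr
  have h2 : ¬ r ≤ elapsed α (stageAt α r - 1) :=
    fun h => absurd (Nat.sInf_le (s := {n | r ≤ elapsed α n}) h) (by unfold stageAt at hr ⊢; omega)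
  have h3 := elapsed_succ (α := α) (stageAt α r - 1)
  rw [Nat.sub_add_cancel hr] at h3
  linarith [not_le.1 h2]

/-- Increments bounded by `K α` from stage `N` on add up to `K` times the elapsed time. -/
lemma abs_sub_le_mul_elapsed {z : ℕ → ℝ} {K : ℝ} {N : ℕ}
    (hz : ∀ k, N ≤ k → |z (k + 1) - z k| ≤ K * α k) {m n : ℕ} (hN : N ≤ m) (hmn : m ≤ n) :
    |z n - z m| ≤ K * (elapsed α n - elapsed α m) := by
  induction n, hmn using Nat.le_induction with
  | base => simp
  | succ n hmn ih =>
    have h1 := hz n (hN.trans hmn)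
    have h2 := abs_sub_le (z (n + 1)) (z n) (z m)
    rw [elapsed_succ]
    linarith

/-- The shift by time `t` of stage `e`. -/
noncomputable def shiftStage (α : ℕ → ℝ) (t : ℝ) (e : ℕ) : ℕ := stageAt α (elapsed α e + t)

lemma tendsto_shiftStage (h0 : ∀ k, 0 ≤ α k) (hS : Tendsto (elapsed α) atTop atTop) (t : ℝ) :
    Tendsto (shiftStage α t) atTop atTop :=
  (tendsto_stageAt h0 hS).comp (tendsto_atTop_add_const_right _ t hS)

lemma tendsto_elapsed_shiftStage_sub (h0 : ∀ k, 0 ≤ α k) (hα : Tendsto α atTop (𝓝 0))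
    (hS : Tendsto (elapsed α) atTop atTop) (t : ℝ) :
    Tendsto (fun e => elapsed α (shiftStage α t e) - elapsed α e) atTop (𝓝 t) := by
  have h := ((tendsto_elapsed_stageAt_sub h0 hα hS).comp
    (tendsto_atTop_add_const_right _ t hS)).add_const t
  rw [zero_add] at h
  refine h.congr fun e => ?_
  simp only [Function.comp, shiftStage]
  ring

lemma tendsto_elapsed_shiftStage_sub_shiftStage (h0 : ∀ k, 0 ≤ α k) (hα : Tendsto α atTop (𝓝 0))
    (hS : Tendsto (elapsed α) atTop atTop) (s t : ℝ) :
    Tendsto (fun e => elapsed α (shiftStage α t e) - elapsed α (shiftStage α s e)) atTop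
      (𝓝 (t - s)) :=
  ((tendsto_elapsed_shiftStage_sub h0 hα hS t).sub
    (tendsto_elapsed_shiftStage_sub h0 hα hS s)).congr fun e => by ring

lemma shiftStage_mono (hS : Tendsto (elapsed α) atTop atTop) {s t : ℝ} (h : s ≤ t) (e : ℕ) :
    shiftStage α s e ≤ shiftStage α t e :=
  stageAt_mono hS (by linarith)

/-- `Z` is the limit along `l` of the sequence `z`, recentered at stage `e` and run in the
time scale in which stage `k` lasts `α k`. -/
def IsLimitPath (α : ℕ → ℝ) (l : Filter ℕ) (z : ℕ → ℝ) (Z : ℝ → ℝ) : Prop :=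
  ∀ t, Tendsto (fun e => z (shiftStage α t e)) l (𝓝 (Z t))

lemma exists_isLimitPath (u : Ultrafilter ℕ) {z : ℕ → ℝ} {C : ℝ} (hz : ∀ k, |z k| ≤ C) :
    ∃ Z, IsLimitPath α u z Z := by
  have h : ∀ t : ℝ, ∃ a, Tendsto (fun e => z (shiftStage α t e)) u (𝓝 a) := by
    intro t
    obtain ⟨a, -, ha⟩ := isCompact_iff_ultrafilter_le_nhds'.1
      (isCompact_Icc (a := -C) (b := C)) (u.map fun e => z (shiftStage α t e))
      (Filter.mem_map.2 (Filter.univ_mem' fun e => abs_le.1 (hz _)))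
    exact ⟨a, ha⟩
  choose Z hZ using h
  exact ⟨Z, hZ⟩

variable {l : Filter ℕ}

lemma IsLimitPath.abs_sub_le [l.NeBot] (h0 : ∀ k, 0 ≤ α k) (hα : Tendsto α atTop (𝓝 0))
    (hS : Tendsto (elapsed α) atTop atTop) (hl : l ≤ atTop) {z : ℕ → ℝ} {Z : ℝ → ℝ} {K : ℝ}
    (hZ : IsLimitPath α l z Z) (hz : ∀ᶠ k in atTop, |z (k + 1) - z k| ≤ K * α k)
    (s t : ℝ) : |Z t - Z s| ≤ K * |t - s| := by
  wlog hst : s ≤ t generalizing s t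
  · rw [abs_sub_comm, abs_sub_comm t]
    exact this t s (le_of_not_ge hst)
  obtain ⟨N, hN⟩ := eventually_atTop.1 hz
  rw [abs_of_nonneg (sub_nonneg.2 hst)]
  refine le_of_tendsto_of_tendsto ((hZ t).sub (hZ s)).abs
    (((tendsto_elapsed_shiftStage_sub_shiftStage h0 hα hS s t).mono_left hl).const_mul K) ?_
  filter_upwards [((tendsto_shiftStage h0 hS s).mono_left hl).eventually_ge_atTop N] with e he
  exact abs_sub_le_mul_elapsed hN he (shiftStage_mono hS hst e)

lemma IsLimitPath.eq_of_forall_eventually [l.NeBot] (h0 : ∀ k, 0 ≤ α k) (hα : Tendsto α atTop (𝓝 0))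
    (hS : Tendsto (elapsed α) atTop atTop) (hl : l ≤ atTop) {z : ℕ → ℝ} {Z : ℝ → ℝ}
    (hZ : IsLimitPath α l z Z)
    (hz : ∀ δ > 0, ∀ᶠ k in atTop, |z (k + 1) - z k| ≤ δ * α k) (s t : ℝ) : Z t = Z s := by
  have h1 : |Z t - Z s| ≤ 0 := by
    refine le_of_forall_pos_le_add fun ε hε => ?_
    have h2 := hZ.abs_sub_le h0 hα hS hl (hz (ε / (|t - s| + 1)) (by positivity)) s t
    have h3 : ε / (|t - s| + 1) * |t - s| ≤ ε := by
      rw [div_mul_eq_mul_div, div_le_iff₀ (by positivity)]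
      nlinarith [abs_nonneg (t - s)]
    linarith
  exact sub_eq_zero.1 (abs_nonpos_iff.1 h1)

/-- At time `0` the limit path is the limit of the sequence itself. -/
lemma IsLimitPath.tendsto_zero (h0 : ∀ k, 0 ≤ α k)
    (hS : Tendsto (elapsed α) atTop atTop) (hl : l ≤ atTop) {z : ℕ → ℝ} {Z : ℝ → ℝ} {K : ℝ}
    (hZ : IsLimitPath α l z Z) (hz : ∀ᶠ k in atTop, |z (k + 1) - z k| ≤ K * α k) :
    Tendsto z l (𝓝 (Z 0)) := by
  obtain ⟨N, hN⟩ := eventually_atTop.1 hz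
  refine (hZ 0).congr' ?_
  filter_upwards [((tendsto_shiftStage h0 hS 0).mono_left hl).eventually_ge_atTop N] with e he
  have hle : shiftStage α 0 e ≤ e := by
    unfold shiftStage
    rw [add_zero]
    exact Nat.sInf_le (le_refl (elapsed α e))
  have h1 := abs_sub_le_mul_elapsed hN he hle
  unfold shiftStage at h1 ⊢
  rw [add_zero, elapsed_stageAt_elapsed h0 hS, sub_self, mul_zero] at h1
  rw [add_zero]
  exact (sub_eq_zero.1 (abs_nonpos_iff.1 h1)).symm

end Clock

section LimitDerivatives

variable {α : ℕ → ℝ}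

lemma neg_mul_le_sub_of_decay {p : ℕ → ℝ}
    (hstep : ∀ k, |p (k + 1) - p k| ≤ α k) (hdec : ∀ k, -(α k * p k) ≤ p (k + 1) - p k)
    {m n : ℕ} (hmn : m ≤ n) :
    -((elapsed α n - elapsed α m) * (p m + (elapsed α n - elapsed α m))) ≤ p n - p m := by
  have h0 : ∀ k, 0 ≤ α k := fun k => (abs_nonneg _).trans (hstep k)
  induction n, hmn using Nat.le_induction with
  | base => simp
  | succ n hmn ih =>
    have h1 := abs_sub_le_mul_elapsed (z := p) (K := 1) (N := 0)
      (fun k _ => by simpa using hstep k) (Nat.zero_le m) hmn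
    have h2 := elapsed_mono h0 hmn
    rw [elapsed_succ]
    set τ := elapsed α n - elapsed α m with hτ
    rw [show elapsed α n + α n - elapsed α m = τ + α n by rw [hτ]; ring]
    have h3 : p n ≤ p m + τ := by linarith [le_abs_self (p n - p m)]
    have h4 : 0 ≤ τ := sub_nonneg.2 h2
    nlinarith [hdec n, mul_le_mul_of_nonneg_left h3 (h0 n), mul_nonneg h4 (h0 n),
      mul_nonneg (h0 n) (h0 n)]

lemma sub_le_neg_mul_of_decay {p : ℕ → ℝ} (hstep : ∀ k, |p (k + 1) - p k| ≤ α k)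
    {m n : ℕ} (hmn : m ≤ n)
    (hdec : ∀ k, m ≤ k → k < n → p (k + 1) - p k ≤ -(α k * p k)) :
    p n - p m ≤ -((elapsed α n - elapsed α m) * (p m - (elapsed α n - elapsed α m))) := by
  have h0 : ∀ k, 0 ≤ α k := fun k => (abs_nonneg _).trans (hstep k)
  induction n, hmn using Nat.le_induction with
  | base => simp
  | succ n hmn ih =>
    have ih := ih fun k hk hk' => hdec k hk (hk'.trans n.lt_succ_self)
    have h1 := abs_sub_le_mul_elapsed (z := p) (K := 1) (N := 0)
      (fun k _ => by simpa using hstep k) (Nat.zero_le m) hmn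
    have h2 := elapsed_mono h0 hmn
    rw [elapsed_succ]
    set τ := elapsed α n - elapsed α m with hτ
    rw [show elapsed α n + α n - elapsed α m = τ + α n by rw [hτ]; ring]
    have h3 : p m - τ ≤ p n := by linarith [neg_abs_le (p n - p m)]
    have h4 : 0 ≤ τ := sub_nonneg.2 h2
    nlinarith [hdec n hmn n.lt_succ_self, mul_le_mul_of_nonneg_left h3 (h0 n),
      mul_nonneg h4 (h0 n), mul_nonneg (h0 n) (h0 n)]

variable {l : Filter ℕ} [l.NeBot]

lemma IsLimitPath.neg_le_deriv (hα : Tendsto α atTop (𝓝 0))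
    (hS : Tendsto (elapsed α) atTop atTop) (hl : l ≤ atTop) {p : ℕ → ℝ} {P : ℝ → ℝ}
    (hP : IsLimitPath α l p P)
    (hstep : ∀ k, |p (k + 1) - p k| ≤ α k) (hdec : ∀ k, -(α k * p k) ≤ p (k + 1) - p k)
    {t P' : ℝ} (hd : HasDerivAt P P' t) : -P t ≤ P' := by
  have h0 : ∀ k, 0 ≤ α k := fun k => (abs_nonneg _).trans (hstep k)
  refine hd.neg_le_of_increment one_pos fun u hu _ => ?_
  have hτ := (tendsto_elapsed_shiftStage_sub_shiftStage h0 hα hS t (t + u)).mono_left hl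
  rw [add_sub_cancel_left] at hτ
  exact le_of_tendsto_of_tendsto (hτ.mul ((hP t).add hτ)).neg ((hP (t + u)).sub (hP t))
    (.of_forall fun e => neg_mul_le_sub_of_decay hstep hdec
      (shiftStage_mono hS (by linarith) e))

lemma IsLimitPath.deriv_le_neg (hα : Tendsto α atTop (𝓝 0))
    (hS : Tendsto (elapsed α) atTop atTop) (hl : l ≤ atTop) {p z : ℕ → ℝ} {P Z : ℝ → ℝ} {K : ℝ}
    (hK : 0 ≤ K) (hP : IsLimitPath α l p P) (hZ : IsLimitPath α l z Z)
    (hz : ∀ᶠ k in atTop, |z (k + 1) - z k| ≤ K * α k)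
    (hstep : ∀ k, |p (k + 1) - p k| ≤ α k)
    (hdec : ∀ k, 0 < z k → p (k + 1) - p k ≤ -(α k * p k))
    {t P' : ℝ} (hd : HasDerivAt P P' t) (ht : 0 < Z t) : P' ≤ -P t := by
  have h0 : ∀ k, 0 ≤ α k := fun k => (abs_nonneg _).trans (hstep k)
  obtain ⟨N, hN⟩ := eventually_atTop.1 hz
  refine hd.le_neg_of_increment (δ := Z t / (K + 1)) (by positivity) fun u hu hu' => ?_
  have hτ := (tendsto_elapsed_shiftStage_sub_shiftStage h0 hα hS t (t + u)).mono_left hl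
  rw [add_sub_cancel_left] at hτ
  have hpos : 0 < Z t - K * u := by
    rw [lt_div_iff₀ (by positivity)] at hu'
    nlinarith
  refine le_of_tendsto_of_tendsto ((hP (t + u)).sub (hP t)) (hτ.mul ((hP t).sub hτ)).neg ?_
  filter_upwards [((hZ t).sub (hτ.const_mul K)).eventually_const_lt hpos,
    ((tendsto_shiftStage h0 hS t).mono_left hl).eventually_ge_atTop N] with e he heN
  refine sub_le_neg_mul_of_decay hstep (shiftStage_mono hS (by linarith) e) fun k hk hk' => ?_
  refine hdec k ?_
  have h1 := abs_sub_le_mul_elapsed hN heN hk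
  have h2 := mul_le_mul_of_nonneg_left (elapsed_mono h0 hk'.le) hK
  linarith [neg_abs_le (z k - z (shiftStage α t e))]

end LimitDerivatives

section Envelope

/-- Danskin's formula for a maximum of finitely many functions relaxing towards `w`. -/
lemma deriv_eq_of_weighted_maximizers {A : Type*} [Fintype A] {X : A → ℝ → ℝ} {f : ℝ → ℝ}
    {t : ℝ} {a w : A → ℝ} (hle : ∀ i s, X i s ≤ f s) (hf : DifferentiableAt ℝ f t)
    (hX : ∀ i, HasDerivAt (X i) (w i - X i t) t) (ha : ∑ i, a i = 1)
    (hsupp : ∀ i, X i t < f t → a i = 0) : deriv f t = ∑ i, a i * w i - f t := by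
  have h1 : ∀ i, a i * deriv f t = a i * w i - a i * f t := by
    intro i
    rcases (hle i t).lt_or_eq with h | h
    · simp [hsupp i h]
    · have hmin : IsLocalMin (fun s => f s - X i s) t :=
        .of_forall fun s => by simp only [h, sub_self]; linarith [hle i s]
      have h2 := hmin.hasDerivAt_eq_zero (hf.hasDerivAt.sub (hX i))
      rw [h] at h2
      rw [show deriv f t = w i - f t by linarith]
      ring
  calc deriv f t = ∑ i, a i * deriv f t := by rw [← Finset.sum_mul, ha, one_mul]
    _ = ∑ i, a i * w i - f t := by
      simp_rw [h1]
      rw [Finset.sum_sub_distrib, ← Finset.sum_mul, ha, one_mul]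

lemma lipschitzWith_sup' {A : Type*} [Fintype A] [Nonempty A] {X : A → ℝ → ℝ} {K : NNReal}
    (hX : ∀ i s t, |X i t - X i s| ≤ K * |t - s|) :
    LipschitzWith K fun t => Finset.univ.sup' Finset.univ_nonempty fun i => X i t := by
  refine LipschitzWith.of_le_add_mul K fun s t => ?_
  refine Finset.sup'_le _ _ fun i hi => ?_
  have h1 := hX i t s
  have h2 := Finset.le_sup' (fun i => X i t) hi
  rw [Real.dist_eq]
  linarith [le_abs_self (X i s - X i t)]

end Envelope

section BestReply

lemma exists_ultrafilter_of_frequently {ι : Type*} {F : Filter ι} {R : ι → Prop}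
    (h : ∃ᶠ k in F, R k) : ∃ u : Ultrafilter ι, (u : Filter ι) ≤ F ∧ ∀ᶠ k in u, R k := by
  have : (F ⊓ 𝓟 {k | R k}).NeBot := Filter.frequently_mem_iff_neBot.1 h
  exact ⟨Ultrafilter.of _, (Ultrafilter.of_le _).trans inf_le_left,
    Filter.le_principal_iff.1 ((Ultrafilter.of_le _).trans inf_le_right)⟩

lemma le_one_of_mem_stdSimplex {A : Type*} [Fintype A] {x : A → ℝ} (hx : x ∈ stdSimplex ℝ A)
    (a : A) : x a ≤ 1 := by
  rw [← hx.2]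
  exact Finset.single_le_sum (fun i _ => hx.1 i) (Finset.mem_univ a)

lemma abs_mul_indicator_sub_le {A : Type*} [Fintype A] {x : A → ℝ} (hx : x ∈ stdSimplex ℝ A)
    {η : ℝ} (hη : 0 ≤ η) (a : A) (c : Prop) [Decidable c] :
    |η * ((if c then (1 : ℝ) else 0) - x a)| ≤ η := by
  have h1 := hx.1 a
  have h2 := le_one_of_mem_stdSimplex hx a
  rw [abs_mul, abs_of_nonneg hη]
  refine mul_le_of_le_one_right hη (abs_le.2 ?_)
  split_ifs <;> constructor <;> linarith

variable {A B : Type*} [Fintype A] [Fintype B] [DecidableEq A]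

/-- Beliefs `p` on a player who at each stage with a positive step best-replies to the beliefs
`q` in the slowly varying payoff matrix `M`. -/
structure IsBestReplyDynamics (α : ℕ → ℝ) (p : ℕ → A → ℝ) (q : ℕ → B → ℝ)
    (M : ℕ → A → B → ℝ) (C : ℝ) : Prop where
  mem_simplex : ∀ k, p k ∈ stdSimplex ℝ A
  opponent_mem_simplex : ∀ k, q k ∈ stdSimplex ℝ B
  step : ∀ k, ∃ i, (∀ a, p (k + 1) a = p k a + α k * ((if a = i then (1 : ℝ) else 0) - p k a)) ∧
    (0 < α k → ∀ a, ∑ b, M k a b * q k b ≤ ∑ b, M k i b * q k b)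
  opponent_step : ∀ k b, |q (k + 1) b - q k b| ≤ α k
  bound : ∀ k a b, |M k a b| ≤ C
  slow : ∀ δ > 0, ∀ᶠ k in atTop, ∀ a b, |M (k + 1) a b - M k a b| ≤ δ * α k

namespace IsBestReplyDynamics

variable {α : ℕ → ℝ} {p : ℕ → A → ℝ} {q : ℕ → B → ℝ} {M : ℕ → A → B → ℝ} {C : ℝ}

lemma abs_step_le (h : IsBestReplyDynamics α p q M C) (h0 : ∀ k, 0 ≤ α k) (k : ℕ) (a : A) :
    |p (k + 1) a - p k a| ≤ α k := by
  obtain ⟨i, hi, -⟩ := h.step k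
  rw [hi, add_sub_cancel_left]
  exact abs_mul_indicator_sub_le (h.mem_simplex k) (h0 k) a _

lemma neg_mul_le_step (h : IsBestReplyDynamics α p q M C) (h0 : ∀ k, 0 ≤ α k) (k : ℕ) (a : A) :
    -(α k * p k a) ≤ p (k + 1) a - p k a := by
  obtain ⟨i, hi, -⟩ := h.step k
  rw [hi]
  split_ifs <;> nlinarith [h0 k]

lemma step_le_of_not_best (h : IsBestReplyDynamics α p q M C) (h0 : ∀ k, 0 ≤ α k) (k : ℕ)
    (a a' : A) (hlt : 0 < ∑ b, M k a' b * q k b - ∑ b, M k a b * q k b) :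
    p (k + 1) a - p k a ≤ -(α k * p k a) := by
  obtain ⟨i, hi, hbr⟩ := h.step k
  rcases (h0 k).eq_or_lt with hk | hk
  · rw [hi, ← hk]; simp
  · have hne : a ≠ i := by
      rintro rfl
      linarith [hbr hk a']
    rw [hi, if_neg hne]
    linarith

lemma payoff_step (h : IsBestReplyDynamics α p q M C) :
    ∀ᶠ k in atTop, ∀ a, |∑ b, M (k + 1) a b * q (k + 1) b - ∑ b, M k a b * q k b|
      ≤ (Fintype.card B * (1 + C)) * α k := by
  filter_upwards [h.slow 1 one_pos] with k hk a
  rw [← Finset.sum_sub_distrib]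
  refine (Finset.abs_sum_le_sum_abs _ _).trans ?_
  have hterm : ∀ b ∈ (Finset.univ : Finset B),
      |M (k + 1) a b * q (k + 1) b - M k a b * q k b| ≤ (1 + C) * α k := by
    intro b _
    have h1 : M (k + 1) a b * q (k + 1) b - M k a b * q k b =
        (M (k + 1) a b - M k a b) * q (k + 1) b + M k a b * (q (k + 1) b - q k b) := by ring
    have h2 := (h.opponent_mem_simplex (k + 1)).1 b
    have h3 := le_one_of_mem_stdSimplex (h.opponent_mem_simplex (k + 1)) b
    have h4 : |(M (k + 1) a b - M k a b) * q (k + 1) b| ≤ α k := by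
      rw [abs_mul, abs_of_nonneg h2]
      refine (mul_le_of_le_one_right (abs_nonneg _) h3).trans ?_
      simpa using hk a b
    have h5 : |M k a b * (q (k + 1) b - q k b)| ≤ C * α k := by
      rw [abs_mul]
      exact mul_le_mul (h.bound k a b) (h.opponent_step k b) (abs_nonneg _)
        ((abs_nonneg _).trans (h.bound k a b))
    rw [h1]
    linarith [abs_add_le ((M (k + 1) a b - M k a b) * q (k + 1) b)
      (M k a b * (q (k + 1) b - q k b))]
  refine (Finset.sum_le_card_nsmul _ _ _ hterm).trans_eq ?_
  rw [nsmul_eq_mul, Finset.card_univ]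
  ring

variable {l : Filter ℕ} [l.NeBot] {P : A → ℝ → ℝ} {Q : B → ℝ → ℝ} {N : A → B → ℝ}

omit [Fintype A] [DecidableEq A] [l.NeBot] in
lemma isLimitPath_payoff (hQ : ∀ b, IsLimitPath α l (fun k => q k b) (Q b))
    (hN : ∀ a b, IsLimitPath α l (fun k => M k a b) fun _ => N a b) (a : A) :
    IsLimitPath α l (fun k => ∑ b, M k a b * q k b) fun t => ∑ b, N a b * Q b t := fun t =>
  tendsto_finsetSum _ fun b _ => (hN a b t).mul (hQ b t)

omit [DecidableEq A] in
lemma sum_path_eq_one (hp : ∀ k, p k ∈ stdSimplex ℝ A)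
    (hP : ∀ a, IsLimitPath α l (fun k => p k a) (P a)) (t : ℝ) : ∑ a, P a t = 1 := by
  have h1 := tendsto_finsetSum Finset.univ fun a _ => hP a t
  refine tendsto_nhds_unique h1 ?_
  simp only [(hp _).2]
  exact tendsto_const_nhds

omit [DecidableEq A] in
lemma sum_deriv_add_eq_one (hp : ∀ k, p k ∈ stdSimplex ℝ A)
    (hP : ∀ a, IsLimitPath α l (fun k => p k a) (P a)) {t : ℝ}
    (hd : ∀ a, DifferentiableAt ℝ (P a) t) : ∑ a, (deriv (P a) t + P a t) = 1 := by
  have h1 : HasDerivAt (fun s => ∑ a, P a s) (∑ a, deriv (P a) t) t :=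
    HasDerivAt.fun_sum fun a _ => (hd a).hasDerivAt
  simp only [sum_path_eq_one hp hP] at h1
  rw [Finset.sum_add_distrib, sum_path_eq_one hp hP, h1.unique (hasDerivAt_const t 1), zero_add]

lemma deriv_add_nonneg (h : IsBestReplyDynamics α p q M C) (h0 : ∀ k, 0 ≤ α k)
    (hα : Tendsto α atTop (𝓝 0)) (hS : Tendsto (elapsed α) atTop atTop) (hl : l ≤ atTop)
    (hP : ∀ a, IsLimitPath α l (fun k => p k a) (P a)) {t : ℝ} {a : A}
    (hd : DifferentiableAt ℝ (P a) t) : 0 ≤ deriv (P a) t + P a t := by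
  have := (hP a).neg_le_deriv hα hS hl
    (fun k => h.abs_step_le h0 k a) (fun k => h.neg_mul_le_step h0 k a) hd.hasDerivAt
  linarith

/-- Along a limit path, the best-reply value relaxes towards the current payoff. -/
lemma deriv_value [Nonempty A] (h : IsBestReplyDynamics α p q M C) (h0 : ∀ k, 0 ≤ α k)
    (hα : Tendsto α atTop (𝓝 0)) (hS : Tendsto (elapsed α) atTop atTop) (hl : l ≤ atTop)
    (hP : ∀ a, IsLimitPath α l (fun k => p k a) (P a))
    (hQ : ∀ b, IsLimitPath α l (fun k => q k b) (Q b))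
    (hN : ∀ a b, IsLimitPath α l (fun k => M k a b) fun _ => N a b) {t : ℝ}
    (hPd : ∀ a, DifferentiableAt ℝ (P a) t) (hQd : ∀ b, DifferentiableAt ℝ (Q b) t)
    (hfd : DifferentiableAt ℝ
      (fun t => Finset.univ.sup' Finset.univ_nonempty fun a => ∑ b, N a b * Q b t) t) :
    deriv (fun t => Finset.univ.sup' Finset.univ_nonempty fun a => ∑ b, N a b * Q b t) t =
      ∑ a, (deriv (P a) t + P a t) * ∑ b, N a b * (deriv (Q b) t + Q b t) -
        Finset.univ.sup' Finset.univ_nonempty fun a => ∑ b, N a b * Q b t := by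
  refine deriv_eq_of_weighted_maximizers (X := fun a t => ∑ b, N a b * Q b t)
    (fun i s => Finset.le_sup' (fun a => ∑ b, N a b * Q b s) (Finset.mem_univ i)) hfd
    (fun i => ?_) (sum_deriv_add_eq_one h.mem_simplex hP hPd) fun a ha => ?_
  · have h1 : HasDerivAt (fun t => ∑ b, N i b * Q b t) (∑ b, N i b * deriv (Q b) t) t :=
      HasDerivAt.fun_sum fun b _ => (hQd b).hasDerivAt.const_mul _
    convert h1 using 1
    rw [← Finset.sum_sub_distrib]
    exact Finset.sum_congr rfl fun b _ => by ring
  · obtain ⟨a', -, ha'⟩ := Finset.exists_mem_eq_sup' Finset.univ_nonempty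
      fun a => ∑ b, N a b * Q b t
    rw [ha'] at ha
    have hle : deriv (P a) t ≤ -P a t := by
      refine (hP a).deriv_le_neg hα hS hl (K := 2 * (Fintype.card B * (1 + |C|)))
        (by positivity) (z := fun k => ∑ b, M k a' b * q k b - ∑ b, M k a b * q k b)
        (Z := fun t => ∑ b, N a' b * Q b t - ∑ b, N a b * Q b t)
        (fun t => (isLimitPath_payoff hQ hN a' t).sub (isLimitPath_payoff hQ hN a t)) ?_
        (fun k => h.abs_step_le h0 k a) (fun k => h.step_le_of_not_best h0 k a a')
        (hPd a).hasDerivAt (sub_pos.2 ha)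
      filter_upwards [h.payoff_step] with k hk
      have h1 := abs_le.1 (hk a)
      have h2 := abs_le.1 (hk a')
      have h3 : (Fintype.card B * (1 + C)) * α k ≤ (Fintype.card B * (1 + |C|)) * α k := by
        gcongr
        · exact h0 k
        · exact le_abs_self C
      rw [abs_le]
      constructor <;> linarith
    linarith [h.deriv_add_nonneg h0 hα hS hl hP (hPd a)]

omit [l.NeBot] in
lemma tendsto_value [Nonempty A] (h : IsBestReplyDynamics α p q M C) (h0 : ∀ k, 0 ≤ α k)
    (hS : Tendsto (elapsed α) atTop atTop) (hl : l ≤ atTop)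
    (hQ : ∀ b, IsLimitPath α l (fun k => q k b) (Q b))
    (hN : ∀ a b, IsLimitPath α l (fun k => M k a b) fun _ => N a b) :
    Tendsto (fun k => Finset.univ.sup' Finset.univ_nonempty fun a => ∑ b, M k a b * q k b) l
      (𝓝 (Finset.univ.sup' Finset.univ_nonempty fun a => ∑ b, N a b * Q b 0)) :=
  Tendsto.finset_sup'_nhds_apply _ fun a _ =>
    (isLimitPath_payoff hQ hN a).tendsto_zero h0 hS hl (h.payoff_step.mono fun _ hk => hk a)

lemma lipschitzWith_value [Nonempty A] (h : IsBestReplyDynamics α p q M C) (h0 : ∀ k, 0 ≤ α k)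
    (hα : Tendsto α atTop (𝓝 0)) (hS : Tendsto (elapsed α) atTop atTop) (hl : l ≤ atTop)
    (hQ : ∀ b, IsLimitPath α l (fun k => q k b) (Q b))
    (hN : ∀ a b, IsLimitPath α l (fun k => M k a b) fun _ => N a b) :
    LipschitzWith (Fintype.card B * (1 + C)).toNNReal fun t =>
      Finset.univ.sup' Finset.univ_nonempty fun a => ∑ b, N a b * Q b t :=
  lipschitzWith_sup' fun a s t => ((isLimitPath_payoff hQ hN a).abs_sub_le h0 hα hS hl
    (h.payoff_step.mono fun _ hk => hk a) s t).trans
    (mul_le_mul_of_nonneg_right (Real.le_coe_toNNReal _) (abs_nonneg _))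

lemma ae_differentiableAt_path (h : IsBestReplyDynamics α p q M C) (h0 : ∀ k, 0 ≤ α k)
    (hα : Tendsto α atTop (𝓝 0)) (hS : Tendsto (elapsed α) atTop atTop) (hl : l ≤ atTop)
    (hP : ∀ a, IsLimitPath α l (fun k => p k a) (P a)) :
    ∀ᵐ t, ∀ a, DifferentiableAt ℝ (P a) t := by
  refine MeasureTheory.ae_all_iff.2 fun a => ?_
  refine LipschitzWith.ae_differentiableAt_real (C := 1) (LipschitzWith.of_dist_le_mul ?_)
  intro s t
  rw [Real.dist_eq, Real.dist_eq]
  exact (hP a).abs_sub_le h0 hα hS hl (K := (1 : NNReal))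
    (.of_forall fun k => by simpa using h.abs_step_le h0 k a) t s

omit [DecidableEq A] in
lemma exists_strategy_path {q : ℕ → A → ℝ} (u : Ultrafilter ℕ) (hq : ∀ k, q k ∈ stdSimplex ℝ A) :
    ∃ Q : A → ℝ → ℝ, ∀ a, IsLimitPath α u (fun k => q k a) (Q a) := by
  choose Q hQ using fun a => exists_isLimitPath (α := α) u (z := fun k => q k a) (C := 1)
    fun k => by
      rw [abs_of_nonneg ((hq k).1 a)]
      exact le_one_of_mem_stdSimplex (hq k) a
  exact ⟨Q, hQ⟩

lemma exists_payoff_limit (h : IsBestReplyDynamics α p q M C) (h0 : ∀ k, 0 ≤ α k)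
    (hα : Tendsto α atTop (𝓝 0)) (hS : Tendsto (elapsed α) atTop atTop) (u : Ultrafilter ℕ)
    (hu : (u : Filter ℕ) ≤ atTop) :
    ∃ N : A → B → ℝ, (∀ a b, IsLimitPath α u (fun k => M k a b) fun _ => N a b) ∧
      ∀ a b, Tendsto (fun k => M k a b) u (𝓝 (N a b)) := by
  choose Z hZ using fun a b => exists_isLimitPath (α := α) u (z := fun k => M k a b)
    fun k => h.bound k a b
  refine ⟨fun a b => Z a b 0, fun a b t => ?_, fun a b =>
    (hZ a b).tendsto_zero h0 hS hu ((h.slow 1 one_pos).mono fun k hk => hk a b)⟩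
  have hc := (hZ a b).eq_of_forall_eventually h0 hα hS hu
    (fun δ hδ => (h.slow δ hδ).mono fun k hk => hk a b) 0 t
  change Tendsto _ _ (𝓝 (Z a b 0))
  rw [← hc]
  exact hZ a b t

/-- Fictitious play in a slowly varying bimatrix game: the sum of the best-reply values is
eventually at most the largest joint payoff, up to an arbitrarily small error. -/
theorem eventually_value_add_lt [DecidableEq B] [Nonempty A] [Nonempty B]
    {M' : ℕ → B → A → ℝ} (h : IsBestReplyDynamics α p q M C)
    (h' : IsBestReplyDynamics α q p M' C) (h0 : ∀ k, 0 ≤ α k)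
    (hα : Tendsto α atTop (𝓝 0)) (hS : Tendsto (elapsed α) atTop atTop) {ε : ℝ} (hε : 0 < ε) :
    ∀ᶠ k in atTop, ∃ a b,
      (Finset.univ.sup' Finset.univ_nonempty fun a => ∑ b, M k a b * q k b) +
        (Finset.univ.sup' Finset.univ_nonempty fun b => ∑ a, M' k b a * p k a) <
      M k a b + M' k b a + ε := by
  by_contra hcon
  rw [not_eventually] at hcon
  push Not at hcon
  obtain ⟨u, hu, hbad⟩ := exists_ultrafilter_of_frequently hcon
  obtain ⟨P, hP⟩ := exists_strategy_path (α := α) u h.mem_simplex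
  obtain ⟨Q, hQ⟩ := exists_strategy_path (α := α) u h'.mem_simplex
  obtain ⟨N, hN, hN0⟩ := h.exists_payoff_limit h0 hα hS u hu
  obtain ⟨N', hN', hN0'⟩ := h'.exists_payoff_limit h0 hα hS u hu
  set f : ℝ → ℝ := fun t => Finset.univ.sup' Finset.univ_nonempty fun a => ∑ b, N a b * Q b t
    with hf
  set f' : ℝ → ℝ := fun t => Finset.univ.sup' Finset.univ_nonempty fun b => ∑ a, N' b a * P a t
    with hf'
  have hle : ∀ a b, N a b + N' b a ≤ f 0 + f' 0 - ε := by
    intro a b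
    have h1 : N a b + N' b a + ε ≤ f 0 + f' 0 :=
      le_of_tendsto_of_tendsto (((hN0 a b).add (hN0' b a)).add_const ε)
        ((h.tendsto_value h0 hS hu hQ hN).add (h'.tendsto_value h0 hS hu hP hN'))
        (by filter_upwards [hbad] with k hk using hk a b)
    linarith
  have hL := h.lipschitzWith_value h0 hα hS hu hQ hN
  have hL' := h'.lipschitzWith_value h0 hα hS hu hP hN'
  have hW := ((hL.add hL').add (LipschitzWith.const (-(f 0 + f' 0 - ε)))).nonpos_of_ae_deriv_le_neg
    ?_
  · simp only [hf, hf'] at hW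
    linarith
  filter_upwards [h.ae_differentiableAt_path h0 hα hS hu hP,
    h'.ae_differentiableAt_path h0 hα hS hu hQ, hL.ae_differentiableAt_real,
    hL'.ae_differentiableAt_real] with t hPd hQd hfd hfd'
  have e1 := h.deriv_value h0 hα hS hu hP hQ hN hPd hQd hfd
  have e2 := h'.deriv_value h0 hα hS hu hQ hP hN' hQd hPd hfd'
  rw [deriv_add_const, deriv_fun_add hfd hfd', e1, e2]
  set x := fun a => deriv (P a) t + P a t with hx
  set y := fun b => deriv (Q b) t + Q b t with hy
  have hx1 : ∑ a, x a = 1 := sum_deriv_add_eq_one h.mem_simplex hP hPd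
  have hy1 : ∑ b, y b = 1 := sum_deriv_add_eq_one h'.mem_simplex hQ hQd
  have hx0 : ∀ a, 0 ≤ x a := fun a => h.deriv_add_nonneg h0 hα hS hu hP (hPd a)
  have hy0 : ∀ b, 0 ≤ y b := fun b => h'.deriv_add_nonneg h0 hα hS hu hQ (hQd b)
  have hsum : ∑ a, x a * ∑ b, N a b * y b + ∑ b, y b * ∑ a, N' b a * x a ≤ f 0 + f' 0 - ε := by
    calc ∑ a, x a * ∑ b, N a b * y b + ∑ b, y b * ∑ a, N' b a * x a
        = ∑ a, ∑ b, x a * y b * (N a b + N' b a) := by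
          simp_rw [Finset.mul_sum]
          rw [Finset.sum_comm (f := fun b a => y b * (N' b a * x a)), ← Finset.sum_add_distrib]
          refine Finset.sum_congr rfl fun a _ => ?_
          rw [← Finset.sum_add_distrib]
          exact Finset.sum_congr rfl fun b _ => by ring
      _ ≤ ∑ a, ∑ b, x a * y b * (f 0 + f' 0 - ε) := by
          gcongr with a _ b _
          · exact mul_nonneg (hx0 a) (hy0 b)
          · exact hle a b
      _ = f 0 + f' 0 - ε := by
          simp_rw [← Finset.sum_mul, ← Finset.mul_sum, hy1, mul_one, hx1, one_mul]
  linarith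

end IsBestReplyDynamics

end BestReply

section Averaging

/-- Averaging with divergent step sizes forgets the past: an eventual bound on the targets is
inherited, up to an arbitrarily small error. -/
lemma eventually_abs_le_of_averaging {b z w : ℕ → ℝ} {c ε : ℝ} (hb0 : ∀ k, 0 ≤ b k)
    (hb1 : ∀ k, b k ≤ 1) (hS : Tendsto (elapsed b) atTop atTop)
    (hz : ∀ k, z (k + 1) = z k + b k * (w k - z k)) (hw : ∀ᶠ k in atTop, |w k| ≤ c)
    (hε : 0 < ε) : ∀ᶠ k in atTop, |z k| ≤ c + ε := by
  obtain ⟨N, hN⟩ := eventually_atTop.1 hw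
  have hdecay : ∀ n, N ≤ n →
      |z n| - c ≤ |(|z N| - c)| * Real.exp (-(elapsed b n - elapsed b N)) := by
    intro n hn
    induction n, hn using Nat.le_induction with
    | base => simpa using le_abs_self (|z N| - c)
    | succ n hn ih =>
      have h1 : |z (n + 1)| ≤ (1 - b n) * |z n| + b n * c := by
        rw [hz, show z n + b n * (w n - z n) = (1 - b n) * z n + b n * w n by ring]
        refine (abs_add_le _ _).trans ?_
        rw [abs_mul, abs_mul, abs_of_nonneg (hb0 n), abs_of_nonneg (sub_nonneg.2 (hb1 n))]
        linarith [mul_le_mul_of_nonneg_left (hN n hn) (hb0 n)]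
      have h2 : 1 - b n ≤ Real.exp (-b n) := Real.one_sub_le_exp_neg _
      set E := |(|z N| - c)| * Real.exp (-(elapsed b n - elapsed b N)) with hE
      have h3 : |(|z N| - c)| * Real.exp (-(elapsed b (n + 1) - elapsed b N)) =
          E * Real.exp (-b n) := by
        rw [hE, elapsed_succ, mul_assoc, ← Real.exp_add]
        ring_nf
      have h4 : 0 ≤ E := by positivity
      rw [h3]
      nlinarith [mul_le_mul_of_nonneg_left ih (sub_nonneg.2 (hb1 n)),
        mul_le_mul_of_nonneg_left h2 h4]
  have hlim : Tendsto (fun n => |(|z N| - c)| * Real.exp (-(elapsed b n - elapsed b N))) atTop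
      (𝓝 0) := by
    have := (Real.tendsto_exp_neg_atTop_nhds_zero.comp
      (tendsto_atTop_add_const_right atTop (-elapsed b N) hS)).const_mul |(|z N| - c)|
    rw [mul_zero] at this
    exact this
  filter_upwards [hlim.eventually_lt_const hε, eventually_ge_atTop N] with n h1 h2
  linarith [hdecay n h2]

/-- Asynchronous averaging towards targets that contract the eventual bounds tends to zero. -/
lemma tendsto_zero_of_contracting_averaging {ι : Type*} [Finite ι] {b z w : ι → ℕ → ℝ} {γ C : ℝ}
    (hγ0 : 0 ≤ γ) (hγ1 : γ < 1) (hb0 : ∀ i k, 0 ≤ b i k) (hb1 : ∀ i k, b i k ≤ 1)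
    (hS : ∀ i, Tendsto (elapsed (b i)) atTop atTop)
    (hz : ∀ i k, z i (k + 1) = z i k + b i k * (γ * w i k - z i k))
    (hC : ∀ i k, |z i k| ≤ C)
    (hw : ∀ m, (∀ᶠ k in atTop, ∀ i, |z i k| ≤ m) →
      ∀ ε > 0, ∀ᶠ k in atTop, ∀ i, |w i k| ≤ m + ε) (i : ι) :
    Tendsto (z i) atTop (𝓝 0) := by
  set T : Set ℝ := {m | 0 ≤ m ∧ ∀ᶠ k in atTop, ∀ i, |z i k| ≤ m} with hT
  have hC0 : 0 ≤ C := (abs_nonneg _).trans (hC i 0)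
  have hne : T.Nonempty := ⟨C, hC0, .of_forall fun k i => hC i k⟩
  have hbdd : BddBelow T := ⟨0, fun m hm => hm.1⟩
  have hstep : ∀ m ∈ T, sInf T ≤ γ * m := by
    intro m hm
    refine le_of_forall_pos_le_add fun ε hε => ?_
    have h1 : γ * (m + ε / 2) + ε / 2 ∈ T := by
      have := hm.1
      refine ⟨by positivity, eventually_all.2 fun i => ?_⟩
      refine eventually_abs_le_of_averaging (hb0 i) (hb1 i) (hS i) (hz i) ?_ (half_pos hε)
      filter_upwards [hw m hm.2 (ε / 2) (half_pos hε)] with k hk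
      rw [abs_mul, abs_of_nonneg hγ0]
      exact mul_le_mul_of_nonneg_left (hk i) hγ0
    nlinarith [csInf_le hbdd h1]
  have hle : sInf T ≤ γ * sInf T := by
    refine le_of_forall_pos_le_add fun ε hε => ?_
    obtain ⟨m, hm, hlt⟩ := exists_lt_of_csInf_lt hne (lt_add_of_pos_right (sInf T) hε)
    nlinarith [hstep m hm]
  have hL : sInf T ≤ 0 := by nlinarith
  rw [Metric.tendsto_nhds]
  intro ε hε
  obtain ⟨m, hm, hlt⟩ := exists_lt_of_csInf_lt hne (hL.trans_lt hε)
  filter_upwards [hm.2] with k hk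
  rw [Real.dist_eq, sub_zero]
  exact (hk i).trans_lt hlt

end Averaging

lemma abs_sum_mul_le {A : Type*} [Fintype A] {x y : A → ℝ} {c : ℝ} (hy : y ∈ stdSimplex ℝ A)
    (hx : ∀ a, |x a| ≤ c) : |∑ a, x a * y a| ≤ c := by
  calc |∑ a, x a * y a| ≤ ∑ a, |x a * y a| := Finset.abs_sum_le_sum_abs _ _
    _ ≤ ∑ a, c * y a := Finset.sum_le_sum fun a _ => by
      rw [abs_mul, abs_of_nonneg (hy.1 a)]
      exact mul_le_mul_of_nonneg_right (hx a) (hy.1 a)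
    _ = c := by rw [← Finset.mul_sum, hy.2, mul_one]

lemma abs_sup'_le {A : Type*} [Fintype A] [Nonempty A] {x : A → ℝ} {c : ℝ}
    (hx : ∀ a, |x a| ≤ c) : |Finset.univ.sup' Finset.univ_nonempty x| ≤ c := by
  obtain ⟨a, -, ha⟩ := Finset.exists_mem_eq_sup' Finset.univ_nonempty x
  rw [ha]
  exact hx a

namespace MBFP

/-- The step size in effect for state `s` at stage `k` when the `c`-th visit uses `η c`. -/
noncomputable def stepAt (G : MBFP S A1 A2) (η : ℕ → ℝ) (s : S) (k : ℕ) : ℝ :=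
  if s = G.st k then η (G.cnt s k) else 0

variable (G : MBFP S A1 A2)

lemma cnt_succ (s : S) (k : ℕ) : G.cnt s (k + 1) = G.cnt s k + if s = G.st k then 1 else 0 := by
  unfold cnt
  rw [Finset.range_add_one, Finset.filter_insert]
  by_cases h : s = G.st k
  · rw [if_pos h.symm, if_pos h, Finset.card_insert_of_notMem (by simp)]
  · rw [if_neg (Ne.symm h), if_neg h, add_zero]

lemma elapsed_stepAt (η : ℕ → ℝ) (s : S) (k : ℕ) :
    elapsed (G.stepAt η s) k = elapsed η (G.cnt s k) := by
  induction k with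
  | zero => simp [elapsed, cnt]
  | succ k ih =>
    rw [elapsed_succ, ih, cnt_succ, stepAt]
    split_ifs
    · rw [elapsed_succ]
    · simp

lemma stepAt_nonneg {η : ℕ → ℝ} (hη : ∀ c, η c ∈ Set.Ioc (0 : ℝ) 1) (s : S) (k : ℕ) :
    0 ≤ G.stepAt η s k := by
  unfold stepAt
  split_ifs
  exacts [(hη _).1.le, le_rfl]

lemma stepAt_le_one {η : ℕ → ℝ} (hη : ∀ c, η c ∈ Set.Ioc (0 : ℝ) 1) (s : S) (k : ℕ) :
    G.stepAt η s k ≤ 1 := by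
  unfold stepAt
  split_ifs
  exacts [(hη _).2, zero_le_one]

variable {G}

lemma Assumption1.tendsto_elapsed_stepAt (h : G.Assumption1) {η : ℕ → ℝ}
    (hη : Tendsto (fun n => ∑ c ∈ Finset.range n, η c) atTop atTop) (s : S) :
    Tendsto (elapsed (G.stepAt η s)) atTop atTop :=
  (Tendsto.comp hη (h.1 s)).congr fun k => (G.elapsed_stepAt η s k).symm

lemma Assumption1.tendsto_stepAt (h : G.Assumption1) (s : S) :
    Tendsto (G.stepAt G.α s) atTop (𝓝 0) := by
  refine squeeze_zero (G.stepAt_nonneg G.α_mem s) (fun k => ?_) (h.2.2.2.1.comp (h.1 s))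
  unfold stepAt
  split_ifs
  exacts [le_rfl, (G.α_mem _).1.le]

lemma Assumption1.eventually_stepAt_le (h : G.Assumption1) (s : S) {δ : ℝ} (hδ : 0 < δ) :
    ∀ᶠ k in atTop, G.stepAt G.β s k ≤ δ * G.stepAt G.α s k := by
  filter_upwards [(h.2.2.2.2.2.comp (h.1 s)).eventually_lt_const hδ] with k hk
  unfold stepAt
  split_ifs
  · exact ((div_lt_iff₀ (G.α_mem _).1).1 hk).le
  · simp

variable (G)

lemma Q1_succ (s : S) (k : ℕ) (a : A1) (b : A2) : G.Q1 s (k + 1) a b = G.Q1 s k a b +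
    G.stepAt G.β s k * (G.r1 s a b + G.γ * ∑ s', G.vhat1 k s' * G.p s a b s' - G.Q1 s k a b) :=
  congrFun (congrFun (G.Q1_upd s k) a) b

lemma Q2_succ (s : S) (k : ℕ) (a : A1) (b : A2) : G.Q2 s (k + 1) a b = G.Q2 s k a b +
    G.stepAt G.β s k * (G.r2 s a b + G.γ * ∑ s', G.vhat2 k s' * G.p s a b s' - G.Q2 s k a b) :=
  congrFun (congrFun (G.Q2_upd s k) a) b

lemma p_mem_stdSimplex (s : S) (a : A1) (b : A2) : G.p s a b ∈ stdSimplex ℝ S :=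
  ⟨G.p_nonneg s a b, G.p_sum_one s a b⟩

variable {G}

lemma abs_vhat1_le {C : ℝ} {k : ℕ} {s : S} (hQ : ∀ a b, |G.Q1 s k a b| ≤ C) :
    |G.vhat1 k s| ≤ C :=
  abs_sup'_le fun a => abs_sum_mul_le (G.π2_simplex s k) (hQ a)

lemma abs_vhat2_le {C : ℝ} {k : ℕ} {s : S} (hQ : ∀ a b, |G.Q2 s k a b| ≤ C) :
    |G.vhat2 k s| ≤ C :=
  abs_sup'_le fun b => by
    simp_rw [mul_comm (G.π1 s k _)]
    exact abs_sum_mul_le (G.π1_simplex s k) fun a => hQ a b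

lemma abs_target_le {v : S → ℝ} {r C R : ℝ} {s : S} {a : A1} {b : A2} (hC : R + G.γ * C ≤ C)
    (hr : |r| ≤ R) (hv : ∀ s', |v s'| ≤ C) : |r + G.γ * ∑ s', v s' * G.p s a b s'| ≤ C := by
  refine (abs_add_le _ _).trans (le_trans (add_le_add hr ?_) hC)
  rw [abs_mul, abs_of_nonneg G.γ_nonneg]
  exact mul_le_mul_of_nonneg_left (abs_sum_mul_le (G.p_mem_stdSimplex s a b) hv) G.γ_nonneg

lemma abs_average_le {x y η C : ℝ} (h0 : 0 ≤ η) (h1 : η ≤ 1) (hx : |x| ≤ C) (hy : |y| ≤ C) :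
    |x + η * (y - x)| ≤ C := by
  rw [show x + η * (y - x) = (1 - η) * x + η * y by ring]
  refine (abs_add_le _ _).trans ?_
  rw [abs_mul, abs_mul, abs_of_nonneg h0, abs_of_nonneg (sub_nonneg.2 h1)]
  nlinarith [mul_le_mul_of_nonneg_left hx (sub_nonneg.2 h1), mul_le_mul_of_nonneg_left hy h0]

variable (G)

/-- The beliefs on the `Q`-functions and the targets of their updates are uniformly bounded. -/
lemma exists_bound : ∃ C, 0 ≤ C ∧ ∀ k s a b,
    (|G.Q1 s k a b| ≤ C ∧ |G.Q2 s k a b| ≤ C) ∧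
    |G.r1 s a b + G.γ * ∑ s', G.vhat1 k s' * G.p s a b s'| ≤ C ∧
    |G.r2 s a b + G.γ * ∑ s', G.vhat2 k s' * G.p s a b s'| ≤ C := by
  obtain ⟨R, hR⟩ := (Set.finite_range fun x : S × A1 × A2 => |G.r1 x.1 x.2.1 x.2.2|).bddAbove
  have hr1 : ∀ s a b, |G.r1 s a b| ≤ R := fun s a b => hR ⟨(s, a, b), rfl⟩
  have hr2 : ∀ s a b, |G.r2 s a b| ≤ R := fun s a b => by
    rw [show G.r2 s a b = -G.r1 s a b by linarith [G.zerosum s a b], abs_neg]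
    exact hr1 s a b
  have hR0 : 0 ≤ R := (abs_nonneg _).trans (hr1 (Classical.arbitrary S) (Classical.arbitrary A1)
    (Classical.arbitrary A2))
  have hγ := sub_pos.2 G.γ_lt_one
  set C := R / (1 - G.γ) with hCdef
  have hC : R + G.γ * C = C := by
    rw [hCdef]
    field_simp
    ring
  have hC0 : 0 ≤ C := by positivity
  have hRC : R ≤ C := by nlinarith [G.γ_nonneg]
  have hQ : ∀ k s a b, |G.Q1 s k a b| ≤ C ∧ |G.Q2 s k a b| ≤ C := by
    intro k
    induction k with
    | zero =>
      intro s a b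
      rw [G.Q1_init, G.Q2_init]
      exact ⟨(hr1 s a b).trans hRC, (hr2 s a b).trans hRC⟩
    | succ k ih =>
      intro s a b
      rw [G.Q1_succ, G.Q2_succ]
      have hβ0 := G.stepAt_nonneg G.β_mem s k
      have hβ1 := G.stepAt_le_one G.β_mem s k
      exact ⟨abs_average_le hβ0 hβ1 (ih s a b).1
          (abs_target_le hC.le (hr1 s a b) fun s' => abs_vhat1_le fun a b => (ih s' a b).1),
        abs_average_le hβ0 hβ1 (ih s a b).2
          (abs_target_le hC.le (hr2 s a b) fun s' => abs_vhat2_le fun a b => (ih s' a b).2)⟩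
  exact ⟨C, hC0, fun k s a b => ⟨hQ k s a b,
    abs_target_le hC.le (hr1 s a b) fun s' => abs_vhat1_le fun a b => (hQ k s' a b).1,
    abs_target_le hC.le (hr2 s a b) fun s' => abs_vhat2_le fun a b => (hQ k s' a b).2⟩⟩

variable {G}

lemma Assumption1.eventually_abs_step_le (h : G.Assumption1) (s : S) {C δ : ℝ} (hC : 0 ≤ C)
    (hδ : 0 < δ) : ∀ᶠ k in atTop, ∀ x y : ℝ, |x| ≤ C → |y| ≤ C →
      |G.stepAt G.β s k * (y - x)| ≤ δ * G.stepAt G.α s k := by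
  filter_upwards [h.eventually_stepAt_le s (δ := δ / (2 * C + 1)) (by positivity)] with k hk x y
    hx hy
  have h0 := G.stepAt_nonneg G.β_mem s k
  have h1 : |y - x| ≤ 2 * C + 1 := by
    rw [abs_le] at *
    constructor <;> linarith
  rw [abs_mul, abs_of_nonneg h0]
  calc G.stepAt G.β s k * |y - x|
      ≤ δ / (2 * C + 1) * G.stepAt G.α s k * (2 * C + 1) :=
        mul_le_mul hk h1 (abs_nonneg _) (h0.trans hk)
    _ = δ * G.stepAt G.α s k := by field_simp

lemma st_eq_of_stepAt_pos {η : ℕ → ℝ} {s : S} {k : ℕ} (h : 0 < G.stepAt η s k) : s = G.st k := by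
  by_contra hne
  simp [stepAt, hne] at h

lemma π1_succ (s : S) (k : ℕ) (a : A1) : G.π1 s (k + 1) a = G.π1 s k a +
    G.stepAt G.α s k * ((if a = G.astar1 k then (1 : ℝ) else 0) - G.π1 s k a) :=
  congrFun (G.π1_upd s k) a

lemma π2_succ (s : S) (k : ℕ) (b : A2) : G.π2 s (k + 1) b = G.π2 s k b +
    G.stepAt G.α s k * ((if b = G.astar2 k then (1 : ℝ) else 0) - G.π2 s k b) :=
  congrFun (G.π2_upd s k) b

lemma abs_π1_step_le (s : S) (k : ℕ) (a : A1) :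
    |G.π1 s (k + 1) a - G.π1 s k a| ≤ G.stepAt G.α s k := by
  rw [π1_succ, add_sub_cancel_left]
  exact abs_mul_indicator_sub_le (G.π1_simplex s k) (G.stepAt_nonneg G.α_mem s k) a _

lemma abs_π2_step_le (s : S) (k : ℕ) (b : A2) :
    |G.π2 s (k + 1) b - G.π2 s k b| ≤ G.stepAt G.α s k := by
  rw [π2_succ, add_sub_cancel_left]
  exact abs_mul_indicator_sub_le (G.π2_simplex s k) (G.stepAt_nonneg G.α_mem s k) b _

/-- At every state, the sum of the value estimates is eventually below the largest entry of the
sum of the `Q`-beliefs, up to an arbitrarily small error. -/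
lemma Assumption1.eventually_vhat_add_lt (h : G.Assumption1) (s : S) {ε : ℝ} (hε : 0 < ε) :
    ∀ᶠ k in atTop, ∃ a b,
      G.vhat1 k s + G.vhat2 k s < G.Q1 s k a b + G.Q2 s k a b + ε := by
  obtain ⟨C, hC0, hC⟩ := G.exists_bound
  have h1 : IsBestReplyDynamics (G.stepAt G.α s) (G.π1 s) (G.π2 s) (G.Q1 s) C :=
    { mem_simplex := G.π1_simplex s
      opponent_mem_simplex := G.π2_simplex s
      step := fun k => ⟨G.astar1 k, π1_succ s k, fun hk a => by
        obtain rfl := st_eq_of_stepAt_pos hk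
        exact G.astar1_br k a⟩
      opponent_step := abs_π2_step_le s
      bound := fun k a b => (hC k s a b).1.1
      slow := fun δ hδ => (h.eventually_abs_step_le s hC0 hδ).mono fun k hk a b => by
        rw [G.Q1_succ, add_sub_cancel_left]
        exact hk _ _ (hC k s a b).1.1 (hC k s a b).2.1 }
  have h2 : IsBestReplyDynamics (G.stepAt G.α s) (G.π2 s) (G.π1 s)
      (fun k b a => G.Q2 s k a b) C :=
    { mem_simplex := G.π2_simplex s
      opponent_mem_simplex := G.π1_simplex s
      step := fun k => ⟨G.astar2 k, π2_succ s k, fun hk b => by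
        obtain rfl := st_eq_of_stepAt_pos hk
        simpa only [mul_comm] using G.astar2_br k b⟩
      opponent_step := abs_π1_step_le s
      bound := fun k b a => (hC k s a b).1.2
      slow := fun δ hδ => (h.eventually_abs_step_le s hC0 hδ).mono fun k hk b a => by
        rw [G.Q2_succ, add_sub_cancel_left]
        exact hk _ _ (hC k s a b).1.2 (hC k s a b).2.2 }
  filter_upwards [h1.eventually_value_add_lt h2 (G.stepAt_nonneg G.α_mem s) (h.tendsto_stepAt s)
    (h.tendsto_elapsed_stepAt h.2.1 s) hε] with k hk
  simpa only [vhat1, vhat2, mul_comm] using hk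

/-- The sum of the value estimates is at least the joint payoff of the believed strategies. -/
lemma neg_le_vhat_add {m : ℝ} {k : ℕ} {s : S} (hm : ∀ a b, |G.Q1 s k a b + G.Q2 s k a b| ≤ m) :
    -m ≤ G.vhat1 k s + G.vhat2 k s := by
  have h1 : ∑ a, (∑ b, G.Q1 s k a b * G.π2 s k b) * G.π1 s k a ≤ G.vhat1 k s := by
    calc ∑ a, (∑ b, G.Q1 s k a b * G.π2 s k b) * G.π1 s k a
        ≤ ∑ a, G.vhat1 k s * G.π1 s k a := Finset.sum_le_sum fun a _ =>
          mul_le_mul_of_nonneg_right (Finset.le_sup' (fun a => ∑ b, G.Q1 s k a b * G.π2 s k b)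
            (Finset.mem_univ a)) ((G.π1_simplex s k).1 a)
      _ = G.vhat1 k s := by rw [← Finset.mul_sum, (G.π1_simplex s k).2, mul_one]
  have h2 : ∑ b, (∑ a, G.π1 s k a * G.Q2 s k a b) * G.π2 s k b ≤ G.vhat2 k s := by
    calc ∑ b, (∑ a, G.π1 s k a * G.Q2 s k a b) * G.π2 s k b
        ≤ ∑ b, G.vhat2 k s * G.π2 s k b := Finset.sum_le_sum fun b _ =>
          mul_le_mul_of_nonneg_right (Finset.le_sup' (fun b => ∑ a, G.π1 s k a * G.Q2 s k a b)
            (Finset.mem_univ b)) ((G.π2_simplex s k).1 b)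
      _ = G.vhat2 k s := by rw [← Finset.mul_sum, (G.π2_simplex s k).2, mul_one]
  have h3 : |∑ a, (∑ b, (G.Q1 s k a b + G.Q2 s k a b) * G.π2 s k b) * G.π1 s k a| ≤ m :=
    abs_sum_mul_le (G.π1_simplex s k) fun a => abs_sum_mul_le (G.π2_simplex s k) (hm a)
  have h4 : ∑ a, (∑ b, (G.Q1 s k a b + G.Q2 s k a b) * G.π2 s k b) * G.π1 s k a =
      ∑ a, (∑ b, G.Q1 s k a b * G.π2 s k b) * G.π1 s k a +
        ∑ b, (∑ a, G.π1 s k a * G.Q2 s k a b) * G.π2 s k b := by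
    simp_rw [Finset.sum_mul]
    rw [Finset.sum_comm (f := fun b a => G.π1 s k a * G.Q2 s k a b * G.π2 s k b),
      ← Finset.sum_add_distrib]
    refine Finset.sum_congr rfl fun a _ => ?_
    rw [← Finset.sum_add_distrib]
    exact Finset.sum_congr rfl fun b _ => by ring
  linarith [neg_abs_le (∑ a, (∑ b, (G.Q1 s k a b + G.Q2 s k a b) * G.π2 s k b) * G.π1 s k a)]

lemma Assumption1.tendsto_Q_add (h : G.Assumption1) (s : S) (a : A1) (b : A2) :
    Tendsto (fun k => G.Q1 s k a b + G.Q2 s k a b) atTop (𝓝 0) := by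
  obtain ⟨C, hC0, hC⟩ := G.exists_bound
  refine tendsto_zero_of_contracting_averaging (ι := S × A1 × A2)
    (b := fun i => G.stepAt G.β i.1)
    (z := fun i k => G.Q1 i.1 k i.2.1 i.2.2 + G.Q2 i.1 k i.2.1 i.2.2)
    (w := fun i k => ∑ s', (G.vhat1 k s' + G.vhat2 k s') * G.p i.1 i.2.1 i.2.2 s')
    (C := C + C) G.γ_nonneg G.γ_lt_one (fun i => G.stepAt_nonneg G.β_mem i.1)
    (fun i => G.stepAt_le_one G.β_mem i.1) (fun i => h.tendsto_elapsed_stepAt h.2.2.1 i.1)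
    ?_ ?_ ?_ (s, a, b)
  · rintro ⟨s, a, b⟩ k
    simp only [G.Q1_succ, G.Q2_succ, add_mul, Finset.sum_add_distrib]
    linear_combination G.stepAt G.β s k * G.zerosum s a b
  · rintro ⟨s, a, b⟩ k
    exact (abs_add_le _ _).trans (add_le_add (hC k s a b).1.1 (hC k s a b).1.2)
  · intro m hm ε hε
    filter_upwards [hm, eventually_all.2 fun s => h.eventually_vhat_add_lt s hε] with k hk hv i
    refine abs_sum_mul_le (G.p_mem_stdSimplex _ _ _) fun s' => abs_le.2 ⟨?_, ?_⟩
    · linarith [neg_le_vhat_add fun a b => hk (s', a, b)]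
    · obtain ⟨a, b, hab⟩ := hv s'
      linarith [le_abs_self (G.Q1 s' k a b + G.Q2 s' k a b), hk (s', a, b)]

end MBFP

/-- Lemma 5 of Sayin–Parise–Ozdaglar: the beliefs on the two players' `Q`-functions
asymptotically sum to zero at every state. -/
theorem q_beliefs_sum_to_zero (G : MBFP S A1 A2) (h : G.Assumption1) (s : S) :
    Tendsto (fun k => maxNorm (fun b1 b2 => G.Q1 s k b1 b2 + G.Q2 s k b1 b2)) atTop (𝓝 0) := by
  have h1 : Tendsto (fun k => maxNorm (fun b1 b2 => G.Q1 s k b1 b2 + G.Q2 s k b1 b2)) atTop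
      (𝓝 (Finset.univ.sup' Finset.univ_nonempty fun _ : A1 × A2 => (0 : ℝ))) :=
    Tendsto.finset_sup'_nhds_apply _ fun q _ => by
      simpa using (h.tendsto_Q_add s q.1 q.2).abs
  rwa [Finset.sup'_const] at h1
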